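/- Let $\mathcal{H}_1, \mathcal{H}_2, \mathcal{H}_3$ be finite-dimensional Hilbert spaces, and let $H_1$ and $H_2$ be commuting self-adjoint operators on $\mathcal{H}_1 \otimes \mathcal{H}_3 \otimes \mathcal{H}_2$ such that $H_1 = A_1 \otimes \mathbf{1}_{\mathcal{H}_2}$ for some operator $A_1$ on $\mathcal{H}_1 \otimes \mathcal{H}_3$ and $H_2 = \mathbf{1}_{\mathcal{H}_1} \otimes A_2$ for some operator $A_2$ on $\mathcal{H}_3 \otimes \mathcal{H}_2$. Then there exists an orthogonal decomposition $\mathcal{H}_3 = \oplus_s (\mathcal{H}_{3,s}^1 \otimes \mathcal{H}_{3,s}^2)$ such that for each $s$: $\mathcal{H}_1 \otimes \mathcal{H}_{3,s}^1 \otimes \mathcal{H}_{3,s}^2$ is invariant under $A_1$ and the restriction of $A_1$ acts as an operator on $\mathcal{H}_1 \otimes \mathcal{H}_{3,s}^1$ tensored with the identity on $\mathcal{H}_{3,s}^2$, and symmetrically, $\mathcal{H}_{3,s}^1 \otimes \mathcal{H}_{3,s}^2 \otimes \mathcal{H}_2$ is invariant under $A_2$ and the restriction acts as the identity on $\mathcal{H}_{3,s}^1$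 tensored with an operator on $\mathcal{H}_{3,s}^2 \otimes \mathcal{H}_2$. -/

import Mathlib

open Matrix
open scoped Kronecker

/-- Reindexing equivalence `ℂ^{n₁} ⊗ (⊕ₛ ℂ^{d₁ s} ⊗ ℂ^{d₂ s}) ≅ ⊕ₛ (ℂ^{n₁} ⊗ ℂ^{d₁ s}) ⊗ ℂ^{d₂ s}`
at the level of index types. -/
def tensorAssoc1 (n₁ k : ℕ) (d₁ d₂ : Fin k → ℕ) :
    (Fin n₁ × Σ s : Fin k, Fin (d₁ s) × Fin (d₂ s)) ≃
      Σ s : Fin k, (Fin n₁ × Fin (d₁ s)) × Fin (d₂ s) where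
  toFun x := ⟨x.2.1, ((x.1, x.2.2.1), x.2.2.2)⟩
  invFun y := (y.2.1.1, ⟨y.1, (y.2.1.2, y.2.2)⟩)
  left_inv := by rintro ⟨a, ⟨s, i, j⟩⟩; rfl
  right_inv := by rintro ⟨s, ⟨⟨a, i⟩, j⟩⟩; rfl

/-- Reindexing equivalence `(⊕ₛ ℂ^{d₁ s} ⊗ ℂ^{d₂ s}) ⊗ ℂ^{n₂} ≅ ⊕ₛ ℂ^{d₁ s} ⊗ (ℂ^{d₂ s} ⊗ ℂ^{n₂})`
at the level of index types. -/
def tensorAssoc2 (n₂ k : ℕ) (d₁ d₂ : Fin k → ℕ) :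
    ((Σ s : Fin k, Fin (d₁ s) × Fin (d₂ s)) × Fin n₂) ≃
      Σ s : Fin k, Fin (d₁ s) × (Fin (d₂ s) × Fin n₂) where
  toFun x := ⟨x.1.1, (x.1.2.1, (x.1.2.2, x.2))⟩
  invFun y := (⟨y.1, (y.2.1, y.2.2.1)⟩, y.2.2.2)
  left_inv := by rintro ⟨⟨s, i, j⟩, b⟩; rfl
  right_inv := by rintro ⟨s, ⟨i, j, b⟩⟩; rfl

/-- A family of matrices whose commutant consists of the scalar matrices only. -/
def HasScalarCommutant {κ m : Type*} [Fintype m] [DecidableEq m] (Y : κ → Matrix m m ℂ) : Prop :=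
  ∀ T : Matrix m m ℂ, (∀ k, Y k * T = T * Y k) → ∃ c : ℂ, T = c • 1

/-- The adjoint of an intertwiner of star-closed families is an intertwiner. -/
theorem conjTranspose_intertwines {κ m n : Type*} [Fintype m] [Fintype n] {σ : κ → κ}
    {Y : κ → Matrix m m ℂ} {Z : κ → Matrix n n ℂ}
    (hY : ∀ k, (Y k)ᴴ = Y (σ k)) (hZ : ∀ k, (Z k)ᴴ = Z (σ k)) (hσ : ∀ k, σ (σ k) = k)
    {T : Matrix m n ℂ} (hT : ∀ k, Y k * T = T * Z k) (k : κ) : Z k * Tᴴ = Tᴴ * Y k := by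
  have h := congrArg conjTranspose (hT (σ k))
  rw [conjTranspose_mul, conjTranspose_mul, hY, hZ, hσ] at h
  exact h.symm

/-- A star-closed family whose commutant is not scalar commutes with a non-scalar Hermitian
matrix. -/
theorem exists_isHermitian_of_not_hasScalarCommutant {κ m : Type*} [Fintype m]
    [DecidableEq m] {σ : κ → κ} {Y : κ → Matrix m m ℂ}
    (hY : ∀ k, (Y k)ᴴ = Y (σ k)) (hσ : ∀ k, σ (σ k) = k) (h : ¬ HasScalarCommutant Y) :
    ∃ T : Matrix m m ℂ, T.IsHermitian ∧ (∀ k, Y k * T = T * Y k) ∧ ∀ c : ℂ, T ≠ c • 1 := by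
  by_contra! hall
  refine h fun T hT => ?_
  have hT' := conjTranspose_intertwines hY hY hσ hT
  obtain ⟨c, hc⟩ := hall (T + Tᴴ) (by simp [IsHermitian, add_comm])
    fun k => by rw [mul_add, add_mul, hT, hT']
  obtain ⟨c', hc'⟩ := hall (Complex.I • (T - Tᴴ))
    (by simp [IsHermitian, conjTranspose_smul, ← smul_neg])
    fun k => by rw [mul_smul_comm, smul_mul_assoc, mul_sub, sub_mul, hT, hT']
  refine ⟨(c - Complex.I * c') / 2, ?_⟩
  have key : T = (1 / 2 : ℂ) • ((T + Tᴴ) - Complex.I • (Complex.I • (T - Tᴴ))) := by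
    rw [smul_smul, Complex.I_mul_I]
    module
  rw [key, hc, hc']
  module

/-- Schur's lemma: a nonzero intertwiner between star-closed families with scalar commutants can
be rescaled to a unitary one. -/
theorem exists_unitary_intertwiner {κ m n : Type*} [Fintype m] [DecidableEq m] [Fintype n]
    [DecidableEq n] {σ : κ → κ} {Y : κ → Matrix m m ℂ} {Z : κ → Matrix n n ℂ}
    (hY : ∀ k, (Y k)ᴴ = Y (σ k)) (hZ : ∀ k, (Z k)ᴴ = Z (σ k)) (hσ : ∀ k, σ (σ k) = k)
    (hYs : HasScalarCommutant Y) (hZs : HasScalarCommutant Z)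
    {T : Matrix m n ℂ} (hT : ∀ k, Y k * T = T * Z k) (hT0 : T ≠ 0) :
    ∃ u : Matrix m n ℂ, uᴴ * u = 1 ∧ u * uᴴ = 1 ∧ ∀ k, Y k * u = u * Z k := by
  have hT' := conjTranspose_intertwines hY hZ hσ hT
  obtain ⟨c, hc⟩ := hZs (Tᴴ * T) fun k => by
    rw [← Matrix.mul_assoc, hT', Matrix.mul_assoc, hT, Matrix.mul_assoc]
  obtain ⟨c', hc'⟩ := hYs (T * Tᴴ) fun k => by
    rw [← Matrix.mul_assoc, hT, Matrix.mul_assoc, hT', Matrix.mul_assoc]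
  have hcc : c = c' := by
    have h : c • T = c' • T := by
      calc c • T = T * (Tᴴ * T) := by rw [hc]; simp
        _ = c' • T := by rw [← Matrix.mul_assoc, hc']; simp
    exact smul_left_injective ℂ hT0 h
  subst hcc
  obtain ⟨i, j, hij⟩ : ∃ i j, T i j ≠ 0 := by
    by_contra! h
    exact hT0 (Matrix.ext h)
  have hcj : c = ((∑ l, ‖T l j‖ ^ 2 : ℝ) : ℂ) := by
    have h := congrFun (congrFun hc j) j
    simp only [mul_apply, conjTranspose_apply, Matrix.smul_apply, one_apply_eq, smul_eq_mul,
      mul_one] at h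
    rw [← h]
    push_cast
    exact Finset.sum_congr rfl fun l _ => by
      rw [RCLike.star_def, Complex.conj_mul']
  have hpos : 0 < ∑ l, ‖T l j‖ ^ 2 :=
    Finset.sum_pos' (fun _ _ => by positivity) ⟨i, Finset.mem_univ _, by positivity⟩
  set r : ℝ := ∑ l, ‖T l j‖ ^ 2
  have hr : ((√r)⁻¹ : ℂ) * ((√r)⁻¹ : ℂ) * c = 1 := by
    have h0 : (√r : ℂ) ≠ 0 := by exact_mod_cast (Real.sqrt_pos.2 hpos).ne'
    have h1 : (√r : ℂ) * √r = c := by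
      rw [hcj]; exact_mod_cast Real.mul_self_sqrt hpos.le
    rw [← h1]
    field_simp
  refine ⟨((√r)⁻¹ : ℂ) • T, ?_, ?_, fun k => ?_⟩
  · simp [conjTranspose_smul, hc, smul_smul, ← mul_assoc, hr]
  · simp [conjTranspose_smul, hc', smul_smul, ← mul_assoc, hr]
  · rw [Matrix.mul_smul, Matrix.smul_mul, hT]

/-- A family commuting with a non-scalar Hermitian matrix is block diagonal with two nonempty
blocks in a suitable orthonormal basis. -/
theorem exists_reducing_unitary {κ ι : Type} [Fintype ι] [DecidableEq ι]
    {X : κ → Matrix ι ι ℂ} {T : Matrix ι ι ℂ} (hT : T.IsHermitian)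
    (hXT : ∀ k, X k * T = T * X k) (hTs : ∀ c : ℂ, T ≠ c • 1) :
    ∃ (p : ι → Prop) (R : Matrix ι ι ℂ), (∃ i, p i) ∧ (∃ i, ¬ p i) ∧ Rᴴ * R = 1 ∧ R * Rᴴ = 1 ∧
      ∀ k i j, (p i ↔ ¬ p j) → (Rᴴ * X k * R) i j = 0 := by
  set R : Matrix ι ι ℂ := (hT.eigenvectorUnitary : Matrix ι ι ℂ)
  have h1 : Rᴴ * R = 1 := Unitary.coe_star_mul_self hT.eigenvectorUnitary
  have h2 : R * Rᴴ = 1 := Unitary.coe_mul_star_self hT.eigenvectorUnitary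
  have hd : T = R * diagonal (fun i => (hT.eigenvalues i : ℂ)) * Rᴴ := by
    have := hT.spectral_theorem
    simpa [R, Unitary.conjStarAlgAut_apply, Function.comp_def, star_eq_conjTranspose] using this
  set D : Matrix ι ι ℂ := diagonal (fun i => (hT.eigenvalues i : ℂ))
  have hne : Nonempty ι := by
    by_contra h
    rw [not_nonempty_iff] at h
    exact hTs 0 (Subsingleton.elim _ _)
  obtain ⟨i₀⟩ := hne
  refine ⟨fun i => hT.eigenvalues i = hT.eigenvalues i₀, R, ⟨i₀, rfl⟩, ?_, h1, h2, ?_⟩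
  · by_contra! h
    refine hTs (hT.eigenvalues i₀) ?_
    have : D = (hT.eigenvalues i₀ : ℂ) • 1 := by
      ext i j
      by_cases hij : i = j
      · subst hij; simp [D, h i]
      · simp [D, hij]
    exact hd.trans (by rw [this]; simp [h2])
  · intro k i j hij
    have hcom : (Rᴴ * X k * R) * D = D * (Rᴴ * X k * R) := by
      calc (Rᴴ * X k * R) * D = Rᴴ * (X k * (R * D * Rᴴ)) * R := by
            simp only [Matrix.mul_assoc, h1, Matrix.mul_one]
        _ = Rᴴ * ((R * D * Rᴴ) * X k) * R := by rw [← hd, hXT]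
        _ = (Rᴴ * R) * D * (Rᴴ * X k * R) := by simp only [Matrix.mul_assoc]
        _ = D * (Rᴴ * X k * R) := by rw [h1, Matrix.one_mul]
    have h := congrFun (congrFun hcom i) j
    rw [mul_diagonal, diagonal_mul, mul_comm, ← sub_eq_zero, ← sub_mul] at h
    rcases mul_eq_zero.1 h with h | h
    · have : hT.eigenvalues i = hT.eigenvalues j := by exact_mod_cast (sub_eq_zero.1 h).symm
      simp only [this] at hij
      tauto
    · exact h

/-- The isometry given by the columns of a unitary matrix in a subset which reduces a family
intertwines the family with its compression. -/
theorem mul_submatrix_eq_of_reduces {ι : Type} [Fintype ι] [DecidableEq ι]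
    {M R : Matrix ι ι ℂ} (hR : R * Rᴴ = 1) {q : ι → Prop} [DecidablePred q]
    (h : ∀ i j, ¬ q i → q j → (Rᴴ * M * R) i j = 0) :
    M * R.submatrix id (Subtype.val : {i // q i} → ι) =
      R.submatrix id (Subtype.val : {i // q i} → ι) *
        ((Rᴴ * M * R).submatrix Subtype.val Subtype.val : Matrix {i // q i} {i // q i} ℂ) := by
  have h1 : M * R = R * (Rᴴ * M * R) := by
    rw [← Matrix.mul_assoc, ← Matrix.mul_assoc, hR, Matrix.one_mul]
  generalize Rᴴ * M * R = K at h h1 ⊢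
  ext i j
  have h2 := congrFun (congrFun h1 i) j.1
  have h3 : (M * R.submatrix id (Subtype.val : {i // q i} → ι)) i j = (M * R) i j := by
    simp [mul_apply]
  have h4 : (R.submatrix id (Subtype.val : {i // q i} → ι) *
      (K.submatrix Subtype.val Subtype.val : Matrix {i // q i} {i // q i} ℂ)) i j =
        ∑ l : {i // q i}, R i l * K l j := rfl
  rw [h3, h2, h4, mul_apply, ← Fintype.sum_subtype_add_sum_subtype q,
    Finset.sum_eq_zero (s := Finset.univ (α := {i // ¬ q i})), add_zero]
  intro l _
  rw [h _ _ l.2 j.2, mul_zero]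

/-- A star-closed family of matrices is an orthogonal direct sum of families with scalar
commutants. -/
theorem exists_decomposition_hasScalarCommutant {κ : Type} {σ : κ → κ} (hσ : ∀ k, σ (σ k) = k)
    (N : ℕ) : ∀ (ι : Type) [Fintype ι] [DecidableEq ι] (_ : Fintype.card ι = N)
      (X : κ → Matrix ι ι ℂ) (_ : ∀ k, (X k)ᴴ = X (σ k)),
    ∃ (I : Type) (_ : Fintype I) (d : I → ℕ) (V : ∀ i, Matrix ι (Fin (d i)) ℂ)
      (Y : ∀ i, κ → Matrix (Fin (d i)) (Fin (d i)) ℂ),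
      (∀ i, (V i)ᴴ * V i = 1) ∧ (∀ i j, i ≠ j → (V i)ᴴ * V j = 0) ∧
      (∑ i, V i * (V i)ᴴ = 1) ∧ (∀ i k, X k * V i = V i * Y i k) ∧
      (∀ i k, (Y i k)ᴴ = Y i (σ k)) ∧ ∀ i, HasScalarCommutant (Y i) := by
  induction N using Nat.strong_induction_on with
  | _ N ih =>
  intro ι _ _ hN X hX
  by_cases hs : HasScalarCommutant X
  · let e := Fintype.equivFin ι
    refine ⟨Unit, inferInstance, fun _ => Fintype.card ι,
      fun _ => (1 : Matrix ι ι ℂ).submatrix id e.symm, fun _ k => (X k).submatrix e.symm e.symm,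
      fun _ => ?_, fun i j h => absurd (Subsingleton.elim i j) h, ?_, fun _ k => ?_,
      fun _ k => ?_, fun _ T hT => ?_⟩
    · change (submatrix 1 id e.symm)ᴴ * submatrix 1 id e.symm = 1
      rw [conjTranspose_submatrix, ← submatrix_mul _ _ _ _ _ Function.bijective_id]
      simp
    · simp [conjTranspose_submatrix, submatrix_mul_equiv]
    · rw [submatrix_mul_equiv, Matrix.one_mul]
      ext i j
      simp [mul_apply, one_apply]
    · rw [conjTranspose_submatrix, hX]
    · obtain ⟨c, hc⟩ := hs (T.submatrix e e) fun k => by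
        have h := congrArg (fun M => M.submatrix e e) (hT k)
        simpa [← submatrix_mul_equiv _ _ _ e] using h
      refine ⟨c, ?_⟩
      have h := congrArg (fun M => M.submatrix e.symm e.symm) hc
      simpa [submatrix_smul] using h
  · obtain ⟨T, hT, hXT, hTs⟩ := exists_isHermitian_of_not_hasScalarCommutant hX hσ hs
    obtain ⟨p, R, ⟨a, ha⟩, ⟨b, hb⟩, hR1, hR2, hR⟩ := exists_reducing_unitary hT hXT hTs
    classical
    have step : ∀ (q : ι → Prop) [DecidablePred q] (P : Matrix ι {i // q i} ℂ),
        P = R.submatrix id Subtype.val → (∃ i, ¬ q i) →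
        (∀ k i j, ¬ q i → q j → (Rᴴ * X k * R) i j = 0) →
        ∃ (I : Type) (_ : Fintype I) (d : I → ℕ) (V : ∀ i, Matrix ι (Fin (d i)) ℂ)
          (Y : ∀ i, κ → Matrix (Fin (d i)) (Fin (d i)) ℂ),
          (∀ i, (V i)ᴴ * V i = 1) ∧ (∀ i j, i ≠ j → (V i)ᴴ * V j = 0) ∧
          (∑ i, V i * (V i)ᴴ = P * Pᴴ) ∧ (∀ i k, X k * V i = V i * Y i k) ∧
          (∀ i k, (Y i k)ᴴ = Y i (σ k)) ∧ (∀ i, HasScalarCommutant (Y i)) ∧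
          ∀ i, ∃ v : Matrix {i // q i} (Fin (d i)) ℂ, V i = P * v := by
      rintro q _ P hP ⟨c, hc⟩ hq
      have hPP : Pᴴ * P = 1 := by
        rw [hP, conjTranspose_submatrix, ← submatrix_mul _ _ _ _ _ Function.bijective_id, hR1,
          submatrix_one _ Subtype.val_injective]
      obtain ⟨I, hI, d, V, Y, h1, h2, h3, h4, h5, h6⟩ := ih (Fintype.card {i // q i})
        (hN ▸ Fintype.card_subtype_lt hc) {i // q i} rfl
        (fun k => (Rᴴ * X k * R).submatrix Subtype.val Subtype.val) (fun k => by
          rw [conjTranspose_submatrix, conjTranspose_mul, conjTranspose_mul,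
            conjTranspose_conjTranspose, hX, Matrix.mul_assoc])
      have key : ∀ i j, (P * V i)ᴴ * (P * V j) = (V i)ᴴ * V j := fun i j => by
        rw [conjTranspose_mul, Matrix.mul_assoc, ← Matrix.mul_assoc _ P, hPP, Matrix.one_mul]
      refine ⟨I, hI, d, fun i => P * V i, Y, fun i => (key i i).trans (h1 i),
        fun i j hij => (key i j).trans (h2 i j hij), ?_, fun i k => ?_, h5, h6,
        fun i => ⟨V i, rfl⟩⟩
      · simp only [conjTranspose_mul, Matrix.mul_assoc]
        rw [← Matrix.mul_sum]
        simp only [← Matrix.mul_assoc]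
        rw [← Matrix.sum_mul, h3, Matrix.one_mul]
      · have h := mul_submatrix_eq_of_reduces hR2 (hq k)
        rw [← hP] at h
        have h' := h4 i k
        rw [← Matrix.mul_assoc, h, Matrix.mul_assoc P, h', Matrix.mul_assoc]
    set P : Matrix ι {i // p i} ℂ := R.submatrix id Subtype.val with hP
    set Q : Matrix ι {i // ¬ p i} ℂ := R.submatrix id Subtype.val with hQ
    obtain ⟨I, hI, d, V, Y, h1, h2, h3, h4, h5, h6, hV⟩ := step p P hP ⟨b, hb⟩
      fun k i j hi hj => hR k i j (by tauto)
    obtain ⟨I', hI', d', V', Y', h1', h2', h3', h4', h5', h6', hV'⟩ := step (fun i => ¬ p i) Q hQ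
      ⟨a, not_not.2 ha⟩ fun k i j hi hj => hR k i j (by tauto)
    have hPQ : Pᴴ * Q = 0 := by
      ext i j
      have := congrFun (congrFun hR1 i.1) j.1
      rw [one_apply_ne (fun h : i.1 = j.1 => j.2 (h ▸ i.2))] at this
      exact this
    have hsum : P * Pᴴ + Q * Qᴴ = 1 := by
      rw [← hR2]
      ext i j
      rw [Matrix.add_apply, mul_apply, mul_apply, mul_apply,
        ← Fintype.sum_subtype_add_sum_subtype p]
      rfl
    have hVV' : ∀ i j, (V i)ᴴ * V' j = 0 := fun i j => by
      obtain ⟨v, hv⟩ := hV i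
      obtain ⟨w, hw⟩ := hV' j
      rw [hv, hw, conjTranspose_mul, Matrix.mul_assoc, ← Matrix.mul_assoc _ Q, hPQ,
        Matrix.zero_mul, Matrix.mul_zero]
    have hV'V : ∀ i j, (V' i)ᴴ * V j = 0 := fun i j => by
      rw [← conjTranspose_conjTranspose (V j), ← conjTranspose_mul, hVV', conjTranspose_zero]
    refine ⟨I ⊕ I', inferInstance, Sum.elim d d', Sum.rec V V', Sum.rec Y Y',
      Sum.rec h1 h1', ?_, ?_, Sum.rec h4 h4', Sum.rec h5 h5', Sum.rec h6 h6'⟩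
    · rintro (i | i) (j | j) hij
      · exact h2 i j fun h => hij (congrArg Sum.inl h)
      · exact hVV' i j
      · exact hV'V i j
      · exact h2' i j fun h => hij (congrArg Sum.inr h)
    · rw [Fintype.sum_sum_type, ← hsum]
      exact congrArg₂ _ h3 h3'

/-- A star-closed family of matrices is an orthogonal direct sum of pairwise inequivalent families
with scalar commutants, repeated with multiplicities. -/
theorem exists_isotypic_decomposition {κ ι : Type} [Fintype ι] [DecidableEq ι] {σ : κ → κ}
    (hσ : ∀ k, σ (σ k) = k) (X : κ → Matrix ι ι ℂ) (hX : ∀ k, (X k)ᴴ = X (σ k)) :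
    ∃ (m : ℕ) (d₁ d₂ : Fin m → ℕ) (W : ∀ s, Fin (d₂ s) → Matrix ι (Fin (d₁ s)) ℂ)
      (Z : ∀ s, κ → Matrix (Fin (d₁ s)) (Fin (d₁ s)) ℂ),
      (∀ s b, (W s b)ᴴ * W s b = 1) ∧ (∀ s b b', b ≠ b' → (W s b)ᴴ * W s b' = 0) ∧
      (∀ s s' b b', s ≠ s' → (W s b)ᴴ * W s' b' = 0) ∧
      (∑ s, ∑ b, W s b * (W s b)ᴴ = 1) ∧ (∀ s b k, X k * W s b = W s b * Z s k) ∧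
      (∀ s k, (Z s k)ᴴ = Z s (σ k)) ∧ (∀ s, HasScalarCommutant (Z s)) ∧
      ∀ s s', s ≠ s' → ∀ T : Matrix (Fin (d₁ s)) (Fin (d₁ s')) ℂ,
        (∀ k, Z s k * T = T * Z s' k) → T = 0 := by
  classical
  obtain ⟨I, _, d, V, Y, h1, h2, h3, h4, h5, h6⟩ :=
    exists_decomposition_hasScalarCommutant hσ _ ι rfl X hX
  let r : Setoid I :=
    { r := fun i j => ∃ u : Matrix (Fin (d i)) (Fin (d j)) ℂ, uᴴ * u = 1 ∧ u * uᴴ = 1 ∧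
        ∀ k, Y i k * u = u * Y j k
      iseqv :=
        { refl := fun i => ⟨1, by simp, by simp, by simp⟩
          symm := fun {i j} ⟨u, hu1, hu2, hu⟩ => ⟨uᴴ, by simpa using hu2, by simpa using hu1,
            conjTranspose_intertwines (h5 i) (h5 j) hσ hu⟩
          trans := fun {i j l} ⟨u, hu1, hu2, hu⟩ ⟨v, hv1, hv2, hv⟩ => ⟨u * v,
            by rw [conjTranspose_mul, Matrix.mul_assoc, ← Matrix.mul_assoc _ u, hu1,
              Matrix.one_mul, hv1],
            by rw [conjTranspose_mul, Matrix.mul_assoc, ← Matrix.mul_assoc v, hv2,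
              Matrix.one_mul, hu2],
            fun k => by rw [← Matrix.mul_assoc, hu, Matrix.mul_assoc, hv, Matrix.mul_assoc]⟩ } }
  let e : Fin (Fintype.card (Quotient r)) ≃ Quotient r := (Fintype.equivFin _).symm
  let f : ∀ s, Fin (Fintype.card {i : I // (⟦i⟧ : Quotient r) = e s}) ≃
      {i : I // (⟦i⟧ : Quotient r) = e s} := fun s => (Fintype.equivFin _).symm
  have hu : ∀ s (b : Fin (Fintype.card {i : I // (⟦i⟧ : Quotient r) = e s})),
      ∃ u : Matrix (Fin (d (f s b).1)) (Fin (d (e s).out)) ℂ, uᴴ * u = 1 ∧ u * uᴴ = 1 ∧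
        ∀ k, Y (f s b).1 k * u = u * Y (e s).out k := fun s b =>
    Quotient.exact (((f s b).2).trans (Quotient.out_eq (e s)).symm)
  choose u hu1 hu2 hu3 using hu
  have key : ∀ s s' b b', (V (f s b).1 * u s b)ᴴ * (V (f s' b').1 * u s' b') =
      (u s b)ᴴ * ((V (f s b).1)ᴴ * V (f s' b').1) * u s' b' := by
    intros
    simp only [conjTranspose_mul, Matrix.mul_assoc]
  refine ⟨_, fun s => d (e s).out, _, fun s b => V (f s b).1 * u s b, fun s => Y (e s).out,
    fun s b => ?_, fun s b b' hb => ?_, fun s s' b b' hs => ?_, ?_, fun s b k => ?_,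
    fun s => h5 _, fun s => h6 _, fun s s' hs T hT => ?_⟩
  · rw [key, h1, Matrix.mul_one, hu1]
  · rw [key, h2 _ _ fun h => hb ((f s).injective (Subtype.ext h)), Matrix.mul_zero,
      Matrix.zero_mul]
  · rw [key, h2 _ _ fun h => hs (e.injective ?_), Matrix.mul_zero, Matrix.zero_mul]
    rw [← (f s b).2, ← (f s' b').2, h]
  · have hb : ∀ s b, V (f s b).1 * u s b * (V (f s b).1 * u s b)ᴴ =
        V (f s b).1 * (V (f s b).1)ᴴ := fun s b => by
      rw [conjTranspose_mul, Matrix.mul_assoc, ← Matrix.mul_assoc (u s b), hu2, Matrix.one_mul]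
    simp only [hb]
    rw [← h3, ← Fintype.sum_fiberwise (fun i => (⟦i⟧ : Quotient r)), ← e.sum_comp]
    exact Finset.sum_congr rfl fun s _ => (f s).sum_comp fun i => V i.1 * (V i.1)ᴴ
  · rw [← Matrix.mul_assoc, h4, Matrix.mul_assoc, hu3, Matrix.mul_assoc]
  · by_contra hT0
    refine hs (e.injective ?_)
    have h : (⟦(e s).out⟧ : Quotient r) = ⟦(e s').out⟧ :=
      Quotient.sound (exists_unitary_intertwiner (h5 _) (h5 _) hσ (h6 _) (h6 _) hT hT0)
    rwa [Quotient.out_eq, Quotient.out_eq] at h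

/-- A star-closed family of matrices and its commutant are simultaneously brought to the forms
`⊕ₛ (Zₛ ⊗ 1)` and `⊕ₛ (1 ⊗ Cₛ)` by a unitary matrix. -/
theorem exists_unitary_blockDiagonal {κ ι : Type} [Fintype ι] [DecidableEq ι] {σ : κ → κ}
    (hσ : ∀ k, σ (σ k) = k) (X : κ → Matrix ι ι ℂ) (hX : ∀ k, (X k)ᴴ = X (σ k)) :
    ∃ (m : ℕ) (d₁ d₂ : Fin m → ℕ)
      (U : Matrix ι (Σ s : Fin m, Fin (d₁ s) × Fin (d₂ s)) ℂ),
      Uᴴ * U = 1 ∧ U * Uᴴ = 1 ∧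
      (∃ Z : ∀ s, κ → Matrix (Fin (d₁ s)) (Fin (d₁ s)) ℂ,
        ∀ k, Uᴴ * X k * U = blockDiagonal' fun s => Z s k ⊗ₖ (1 : Matrix (Fin (d₂ s)) _ ℂ)) ∧
      ∀ y : Matrix ι ι ℂ, (∀ k, X k * y = y * X k) →
        ∃ C : ∀ s, Matrix (Fin (d₂ s)) (Fin (d₂ s)) ℂ,
          Uᴴ * y * U = blockDiagonal' fun s => (1 : Matrix (Fin (d₁ s)) _ ℂ) ⊗ₖ C s := by
  obtain ⟨m, d₁, d₂, W, Z, h1, h2, h3, h4, h5, h6, h7, h8⟩ := exists_isotypic_decomposition hσ X hX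
  let U : Matrix ι (Σ s : Fin m, Fin (d₁ s) × Fin (d₂ s)) ℂ :=
    of fun i x => W x.1 x.2.2 i x.2.1
  have hU : ∀ (M : Matrix ι ι ℂ) s a b s' a' b', (Uᴴ * M * U) ⟨s, (a, b)⟩ ⟨s', (a', b')⟩ =
      ((W s b)ᴴ * M * W s' b') a a' := by
    intros
    simp [U, mul_apply]
  have h5' : ∀ s b k, (W s b)ᴴ * X k = Z s k * (W s b)ᴴ := fun s b k => by
    have h := congrArg conjTranspose (h5 s b (σ k))
    rw [conjTranspose_mul, conjTranspose_mul, hX, h6, hσ] at h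
    exact h
  refine ⟨m, d₁, d₂, U, ?_, ?_, ⟨Z, fun k => ?_⟩, fun y hy => ?_⟩
  · ext ⟨s, a, b⟩ ⟨s', a', b'⟩
    rw [← Matrix.mul_one Uᴴ, hU, Matrix.mul_one]
    by_cases hs : s = s'
    · subst hs
      by_cases hb : b = b'
      · subst hb
        simp [h1, one_apply]
      · simp [h2 s b b' hb, one_apply, hb]
    · simp [h3 s s' b b' hs, one_apply, hs]
  · rw [← h4]
    ext i j
    simp only [mul_apply, Matrix.sum_apply, Fintype.sum_sigma, Fintype.sum_prod_type_right,
      conjTranspose_apply, U, of_apply]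
  · ext ⟨s, a, b⟩ ⟨s', a', b'⟩
    rw [hU, h5', Matrix.mul_assoc]
    by_cases hs : s = s'
    · subst hs
      rw [blockDiagonal'_apply_eq]
      by_cases hb : b = b'
      · subst hb
        simp [h1]
      · simp [h2 s b b' hb, hb]
    · rw [h3 s s' b b' hs, blockDiagonal'_apply_ne _ _ _ hs, Matrix.mul_zero, Matrix.zero_apply]
  · have hint : ∀ s s' b b' k, Z s k * ((W s b)ᴴ * y * W s' b') =
        (W s b)ᴴ * y * W s' b' * Z s' k := fun s s' b b' k => by
      simp only [Matrix.mul_assoc, ← h5]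
      simp only [← Matrix.mul_assoc, ← h5']
      simp only [Matrix.mul_assoc, ← hy]
    choose C hC using fun s b b' => h7 s _ (hint s s b b')
    refine ⟨C, ?_⟩
    ext ⟨s, a, b⟩ ⟨s', a', b'⟩
    rw [hU]
    by_cases hs : s = s'
    · subst hs
      rw [blockDiagonal'_apply_eq, hC]
      exact mul_comm _ _
    · rw [h8 s s' hs _ (hint s s' b b'), blockDiagonal'_apply_ne _ _ _ hs, Matrix.zero_apply]

/-- Lemma 5 of the paper: if `H₁ = A₁ ⊗ 1` and `H₂ = 1 ⊗ A₂` are commuting self-adjoint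
operators on `ℋ₁ ⊗ ℋ₃ ⊗ ℋ₂`, then there is an orthogonal decomposition
`ℋ₃ = ⊕ₛ (ℋ₃ₛ¹ ⊗ ℋ₃ₛ²)` (implemented by a unitary `U`) in which `A₁` acts as
`⊕ₛ (Bₛ ⊗ 1)` on `ℋ₁ ⊗ ℋ₃ₛ¹ ⊗ ℋ₃ₛ²` and `A₂` acts as `⊕ₛ (1 ⊗ Cₛ)` on
`ℋ₃ₛ¹ ⊗ ℋ₃ₛ² ⊗ ℋ₂`. -/
theorem stmt_8 (n₁ n₂ n₃ : ℕ)
    (A₁ : Matrix (Fin n₁ × Fin n₃) (Fin n₁ × Fin n₃) ℂ) (hA₁ : A₁.IsHermitian)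
    (A₂ : Matrix (Fin n₃ × Fin n₂) (Fin n₃ × Fin n₂) ℂ) (hA₂ : A₂.IsHermitian)
    (hcomm : Commute
      ((Matrix.reindex (Equiv.prodAssoc (Fin n₁) (Fin n₃) (Fin n₂))
        (Equiv.prodAssoc (Fin n₁) (Fin n₃) (Fin n₂)))
        (A₁ ⊗ₖ (1 : Matrix (Fin n₂) (Fin n₂) ℂ)))
      ((1 : Matrix (Fin n₁) (Fin n₁) ℂ) ⊗ₖ A₂)) :
    ∃ (k : ℕ) (d₁ d₂ : Fin k → ℕ)
      (U : Matrix (Fin n₃) (Σ s : Fin k, Fin (d₁ s) × Fin (d₂ s)) ℂ),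
      Uᴴ * U = 1 ∧ U * Uᴴ = 1 ∧
      (∃ B : (s : Fin k) → Matrix (Fin n₁ × Fin (d₁ s)) (Fin n₁ × Fin (d₁ s)) ℂ,
        (Matrix.reindex (tensorAssoc1 n₁ k d₁ d₂) (tensorAssoc1 n₁ k d₁ d₂))
            (((1 : Matrix (Fin n₁) (Fin n₁) ℂ) ⊗ₖ U)ᴴ * A₁ *
              ((1 : Matrix (Fin n₁) (Fin n₁) ℂ) ⊗ₖ U)) =
          Matrix.blockDiagonal'
            (fun s => B s ⊗ₖ (1 : Matrix (Fin (d₂ s)) (Fin (d₂ s)) ℂ))) ∧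
      (∃ C : (s : Fin k) → Matrix (Fin (d₂ s) × Fin n₂) (Fin (d₂ s) × Fin n₂) ℂ,
        (Matrix.reindex (tensorAssoc2 n₂ k d₁ d₂) (tensorAssoc2 n₂ k d₁ d₂))
            ((U ⊗ₖ (1 : Matrix (Fin n₂) (Fin n₂) ℂ))ᴴ * A₂ *
              (U ⊗ₖ (1 : Matrix (Fin n₂) (Fin n₂) ℂ))) =
          Matrix.blockDiagonal'
            (fun s => (1 : Matrix (Fin (d₁ s)) (Fin (d₁ s)) ℂ) ⊗ₖ C s)) := by
  obtain ⟨m, d₁, d₂, U, hU1, hU2, ⟨Z, hZ⟩, hC⟩ :=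
    exists_unitary_blockDiagonal (σ := Prod.swap) Prod.swap_swap
      (fun k : Fin n₁ × Fin n₁ => of fun i j => A₁ (k.1, i) (k.2, j))
      fun k => Matrix.ext fun i j => hA₁.apply (k.2, i) (k.1, j)
  have hint : ∀ (r : Fin n₂ × Fin n₂) (k : Fin n₁ × Fin n₁),
      (of fun i j => A₁ (k.1, i) (k.2, j)) * (of fun i j => A₂ (i, r.1) (j, r.2)) =
        (of fun i j => A₂ (i, r.1) (j, r.2)) * (of fun i j => A₁ (k.1, i) (k.2, j)) := by
    rintro ⟨p, q⟩ ⟨α, β⟩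
    ext i j
    have h := congrFun (congrFun hcomm.eq (α, (i, p))) (β, (j, q))
    simpa [mul_apply, Fintype.sum_prod_type, one_apply, ite_and] using h
  choose C hC using fun r => hC _ (hint r)
  refine ⟨m, d₁, d₂, U, hU1, hU2, ⟨fun s => of fun x y => Z s (x.1, y.1) x.2 y.2, ?_⟩,
    ⟨fun s => of fun x y => C (x.2, y.2) s x.1 y.1, ?_⟩⟩
  · ext ⟨s, ⟨⟨α, a⟩, b⟩⟩ ⟨s', ⟨⟨β, a'⟩, b'⟩⟩
    have h := congrFun (congrFun (hZ (α, β)) ⟨s, (a, b)⟩) ⟨s', (a', b')⟩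
    have h' : (((1 : Matrix (Fin n₁) (Fin n₁) ℂ) ⊗ₖ U)ᴴ * A₁ *
        ((1 : Matrix (Fin n₁) (Fin n₁) ℂ) ⊗ₖ U)) (α, ⟨s, (a, b)⟩) (β, ⟨s', (a', b')⟩) =
        (Uᴴ * (of fun i j => A₁ (α, i) (β, j)) * U) ⟨s, (a, b)⟩ ⟨s', (a', b')⟩ := by
      simp [mul_apply, Fintype.sum_prod_type, one_apply, apply_ite, ite_mul]
    refine (h'.trans h).trans ?_
    by_cases hs : s = s'
    · subst hs
      rw [blockDiagonal'_apply_eq, blockDiagonal'_apply_eq]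
      rfl
    · rw [blockDiagonal'_apply_ne _ _ _ hs, blockDiagonal'_apply_ne _ _ _ hs]
  · ext ⟨s, ⟨a, ⟨b, p⟩⟩⟩ ⟨s', ⟨a', ⟨b', q⟩⟩⟩
    have h := congrFun (congrFun (hC (p, q)) ⟨s, (a, b)⟩) ⟨s', (a', b')⟩
    have h' : ((U ⊗ₖ (1 : Matrix (Fin n₂) (Fin n₂) ℂ))ᴴ * A₂ *
        (U ⊗ₖ (1 : Matrix (Fin n₂) (Fin n₂) ℂ))) (⟨s, (a, b)⟩, p) (⟨s', (a', b')⟩, q) =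
        (Uᴴ * (of fun i j => A₂ (i, p) (j, q)) * U) ⟨s, (a, b)⟩ ⟨s', (a', b')⟩ := by
      simp [mul_apply, Fintype.sum_prod_type, one_apply, apply_ite, ite_mul]
    refine (h'.trans h).trans ?_
    by_cases hs : s = s'
    · subst hs
      rw [blockDiagonal'_apply_eq, blockDiagonal'_apply_eq]
      rfl
    · rw [blockDiagonal'_apply_ne _ _ _ hs, blockDiagonal'_apply_ne _ _ _ hs]
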